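/- arXiv:0705.1276 — 2 statements merged into one kernel-verified Lean document; each statement's English description precedes it below -/
import Mathlib

section
/- Let q > 1 be a real number. For any bipartite quantum state ρ (a positive semidefinite matrix with trace 1) on a finite-dimensional bipartite Hilbert space ℂ^{d₁} ⊗ ℂ^{d₂} (i.e., a positive semidefinite matrix indexed by (Fin d₁ × Fin d₂) with trace 1), the Tsallis q-entropy is subadditive: S_q(ρ) ≤ S_q(Tr₁ρ) + S_q(Tr₂ρ). -/
open Matrix ComplexOrder

/-- `Tr[A^q]` for a Hermitian matrix `A`, where `A^q` is the matrix power obtained by raising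
each eigenvalue of `A` to the (real) power `q`; defined as `0` if `A` is not Hermitian. -/
noncomputable def traceRpow {d : Type*} [Fintype d] [DecidableEq d]
    (q : ℝ) (A : Matrix d d ℂ) : ℝ :=
  if hA : A.IsHermitian then ∑ i, hA.eigenvalues i ^ q else 0

/-- The Tsallis `q`-entropy `S_q(A) = (1 − Tr[A^q])/(q − 1)`. -/
noncomputable def tsallisEntropy {d : Type*} [Fintype d] [DecidableEq d]
    (q : ℝ) (A : Matrix d d ℂ) : ℝ :=
  (1 - traceRpow q A) / (q - 1)

/-- The partial trace over the first tensor factor: `(Tr₁ρ)(j,j') = ∑ i, ρ((i,j),(i,j'))`. -/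
noncomputable def ptrace1 {d₁ d₂ : ℕ}
    (ρ : Matrix (Fin d₁ × Fin d₂) (Fin d₁ × Fin d₂) ℂ) : Matrix (Fin d₂) (Fin d₂) ℂ :=
  Matrix.of fun j j' => ∑ i, ρ (i, j) (i, j')

/-- The partial trace over the second tensor factor: `(Tr₂ρ)(i,i') = ∑ j, ρ((i,j),(i',j))`. -/
noncomputable def ptrace2 {d₁ d₂ : ℕ}
    (ρ : Matrix (Fin d₁ × Fin d₂) (Fin d₁ × Fin d₂) ℂ) : Matrix (Fin d₁) (Fin d₁) ℂ :=
  Matrix.of fun i i' => ∑ j, ρ (i, j) (i', j)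

open scoped Kronecker

/-- Subadditivity of the power sums of a nonnegative joint distribution and its marginals. -/
lemma sum_rpow_marginals_le {ι κ : Type*} [Fintype ι] [Fintype κ] {q : ℝ} (hq : 1 < q)
    {r : ι → κ → ℝ} (hr : ∀ i j, 0 ≤ r i j) (hsum : ∑ i, ∑ j, r i j = 1) :
    ∑ i, (∑ j, r i j) ^ q + ∑ j, (∑ i, r i j) ^ q ≤ 1 + ∑ i, ∑ j, r i j ^ q := by
  set l : ι → ℝ := fun i => ∑ j, r i j
  have hl0 : ∀ i, 0 ≤ l i := fun i => Finset.sum_nonneg fun j _ => hr i j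
  have hl1 : ∀ i, l i ≤ 1 := fun i =>
    hsum ▸ Finset.single_le_sum (f := l) (fun i _ => hl0 i) (Finset.mem_univ i)
  have hrl : ∀ i j, r i j = l i * (r i j / l i) := by
    intro i j
    rcases eq_or_ne (l i) 0 with h | h
    · have := (Finset.sum_eq_zero_iff_of_nonneg (fun j _ => hr i j)).1 h j (Finset.mem_univ j)
      simp [h, this]
    · field_simp
  have hs0 : ∀ i j, 0 ≤ r i j / l i := fun i j => div_nonneg (hr i j) (hl0 i)
  set t : ι → ℝ := fun i => ∑ j, (r i j / l i) ^ q with ht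
  have ht1 : ∀ i, t i ≤ 1 := by
    intro i
    have hone : ∀ j, r i j / l i ≤ 1 := fun j =>
      div_le_one_of_le₀ (Finset.single_le_sum (fun j _ => hr i j) (Finset.mem_univ j)) (hl0 i)
    calc t i ≤ ∑ j, r i j / l i := Finset.sum_le_sum fun j _ =>
          Real.rpow_le_self_of_le_one (hs0 i j) (hone j) hq.le
      _ = l i / l i := by rw [← Finset.sum_div]
      _ ≤ 1 := div_self_le_one _
  have hmarg : ∑ j, (∑ i, r i j) ^ q ≤ ∑ i, l i * t i := by
    simp only [ht, Finset.mul_sum]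
    rw [Finset.sum_comm]
    refine Finset.sum_le_sum fun j _ => ?_
    have := (convexOn_rpow hq.le).map_sum_le (t := Finset.univ) (w := l)
      (p := fun i => r i j / l i) (fun i _ => hl0 i) hsum (fun i _ => hs0 i j)
    simpa only [smul_eq_mul, ← hrl] using this
  have hjoint : ∑ i, ∑ j, r i j ^ q = ∑ i, l i ^ q * t i := by
    simp only [ht, Finset.mul_sum]
    refine Finset.sum_congr rfl fun i _ => Finset.sum_congr rfl fun j _ => ?_
    rw [← Real.mul_rpow (hl0 i) (hs0 i j), ← hrl]
  have hmain : 0 ≤ ∑ i, (l i - l i ^ q) * (1 - t i) := Finset.sum_nonneg fun i _ =>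
    mul_nonneg (sub_nonneg.2 (Real.rpow_le_self_of_le_one (hl0 i) (hl1 i) hq.le))
      (sub_nonneg.2 (ht1 i))
  have hexp : ∑ i, (l i - l i ^ q) * (1 - t i) =
      ∑ i, l i - ∑ i, l i ^ q - ∑ i, l i * t i + ∑ i, l i ^ q * t i := by
    simp only [← Finset.sum_sub_distrib, ← Finset.sum_add_distrib]
    exact Finset.sum_congr rfl fun i _ => by ring
  rw [hjoint]
  linarith

section

variable {d : Type*} [Fintype d] [DecidableEq d]

lemma sum_normSq_row_eq_one {V : Matrix d d ℂ} (hV : V * Vᴴ = 1) (k : d) :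
    ∑ l, Complex.normSq (V k l) = 1 := by
  have := congrFun (congrFun hV k) k
  simp only [mul_apply, conjTranspose_apply, one_apply_eq, Complex.star_def,
    Complex.mul_conj] at this
  exact_mod_cast this

lemma sum_normSq_col_eq_one {V : Matrix d d ℂ} (hV : Vᴴ * V = 1) (l : d) :
    ∑ k, Complex.normSq (V k l) = 1 := by
  have := congrFun (congrFun hV l) l
  simp only [mul_apply, conjTranspose_apply, one_apply_eq, Complex.star_def,
    ← Complex.normSq_eq_conj_mul_self] at this
  exact_mod_cast this

lemma re_mul_diagonal_mul_conjTranspose_apply (V : Matrix d d ℂ) (e : d → ℝ) (k : d) :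
    ((V * diagonal (fun l => (e l : ℂ)) * Vᴴ) k k).re =
      ∑ l, Complex.normSq (V k l) * e l := by
  simp only [mul_apply (M := V * _), mul_diagonal, conjTranspose_apply, Complex.re_sum]
  refine Finset.sum_congr rfl fun l _ => ?_
  rw [mul_right_comm, Complex.star_def, Complex.mul_conj, ← Complex.ofReal_mul,
    Complex.ofReal_re]

/-- The `q`-th power sum of the diagonal, in any orthonormal basis, is at most `Tr[A^q]`. -/
lemma sum_diag_rpow_le_traceRpow {q : ℝ} (hq : 1 < q) {A : Matrix d d ℂ} (hA : A.PosSemidef)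
    {W : Matrix d d ℂ} (hW : W ∈ unitaryGroup d ℂ) :
    ∑ k, ((Wᴴ * A * W) k k).re ^ q ≤ traceRpow q A := by
  rw [traceRpow, dif_pos hA.isHermitian]
  set e := hA.isHermitian.eigenvalues
  set E := hA.isHermitian.eigenvectorUnitary
  set V : Matrix d d ℂ := Wᴴ * E with hV
  have hVmem : V ∈ unitaryGroup d ℂ := mul_mem (Unitary.star_mem hW) E.2
  have hdec : Wᴴ * A * W = V * diagonal (fun l => (e l : ℂ)) * Vᴴ := by
    conv_lhs => rw [hA.isHermitian.spectral_theorem, Unitary.conjStarAlgAut_apply]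
    simp only [hV, conjTranspose_mul, conjTranspose_conjTranspose, Matrix.mul_assoc,
      star_eq_conjTranspose]
    rfl
  have hrow := sum_normSq_row_eq_one (mem_unitaryGroup_iff.1 hVmem)
  have hcol := sum_normSq_col_eq_one (mem_unitaryGroup_iff'.1 hVmem)
  calc ∑ k, ((Wᴴ * A * W) k k).re ^ q
      = ∑ k, (∑ l, Complex.normSq (V k l) * e l) ^ q := by
        simp only [hdec, re_mul_diagonal_mul_conjTranspose_apply]
    _ ≤ ∑ k, ∑ l, Complex.normSq (V k l) * e l ^ q := Finset.sum_le_sum fun k _ =>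
        (convexOn_rpow hq.le).map_sum_le (fun l _ => Complex.normSq_nonneg _) (hrow k)
          (fun l _ => hA.eigenvalues_nonneg l)
    _ = ∑ l, e l ^ q := by
        rw [Finset.sum_comm]
        simp only [← Finset.sum_mul, hcol, one_mul]

lemma traceRpow_eq_sum_diag {A : Matrix d d ℂ} (hA : A.IsHermitian) (q : ℝ) :
    traceRpow q A = ∑ k,
      (((hA.eigenvectorUnitary : Matrix d d ℂ)ᴴ * A * hA.eigenvectorUnitary) k k).re ^ q := by
  have h := hA.conjStarAlgAut_star_eigenvectorUnitary
  rw [Unitary.conjStarAlgAut_star_apply, star_eq_conjTranspose] at h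
  rw [traceRpow, dif_pos hA, h]
  simp

end

section

variable {d₁ d₂ : ℕ} {ρ : Matrix (Fin d₁ × Fin d₂) (Fin d₁ × Fin d₂) ℂ}

lemma ptrace1_eq_ptrace2_submatrix_swap (ρ : Matrix (Fin d₁ × Fin d₂) (Fin d₁ × Fin d₂) ℂ) :
    ptrace1 ρ = ptrace2 (ρ.submatrix Prod.swap Prod.swap) := rfl

lemma ptrace2_isHermitian (hρ : ρ.IsHermitian) : (ptrace2 ρ).IsHermitian := by
  ext i i'
  simp [ptrace2, hρ.apply]

lemma ptrace1_isHermitian (hρ : ρ.IsHermitian) : (ptrace1 ρ).IsHermitian :=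
  ptrace2_isHermitian (hρ.submatrix Prod.swap)

lemma ptrace2_conj_kronecker (ρ : Matrix (Fin d₁ × Fin d₂) (Fin d₁ × Fin d₂) ℂ)
    (u : Matrix (Fin d₁) (Fin d₁) ℂ) {v : Matrix (Fin d₂) (Fin d₂) ℂ}
    (hv : v ∈ unitaryGroup (Fin d₂) ℂ) :
    ptrace2 ((u ⊗ₖ v)ᴴ * ρ * (u ⊗ₖ v)) = uᴴ * ptrace2 ρ * u := by
  ext i i'
  have hv' : ∀ d b, ∑ j, v d j * star (v b j) = if d = b then 1 else 0 := by
    intro d b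
    have := congrFun (congrFun (mem_unitaryGroup_iff.1 hv) d) b
    simpa [mul_apply, one_apply] using this
  calc ptrace2 ((u ⊗ₖ v)ᴴ * ρ * (u ⊗ₖ v)) i i'
      = ∑ j, ∑ c, ∑ d, ∑ a, ∑ b, star (u a i) * ρ (a, b) (c, d) * u c i' *
          (v d j * star (v b j)) := by
        simp only [ptrace2, of_apply, mul_apply, conjTranspose_apply, kroneckerMap_apply,
          Fintype.sum_prod_type, Finset.sum_mul, star_mul']
        refine Finset.sum_congr rfl fun j _ => Finset.sum_congr rfl fun c _ =>
          Finset.sum_congr rfl fun d _ => Finset.sum_congr rfl fun a _ =>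
          Finset.sum_congr rfl fun b _ => by ring
    _ = ∑ c, ∑ d, ∑ a, ∑ b, star (u a i) * ρ (a, b) (c, d) * u c i' *
          ∑ j, v d j * star (v b j) := by
        simp only [Finset.mul_sum]
        rw [Finset.sum_comm]
        refine Finset.sum_congr rfl fun c _ => ?_
        rw [Finset.sum_comm]
        refine Finset.sum_congr rfl fun d _ => ?_
        rw [Finset.sum_comm]
        refine Finset.sum_congr rfl fun a _ => ?_
        rw [Finset.sum_comm]
    _ = ∑ c, ∑ d, ∑ a, star (u a i) * ρ (a, d) (c, d) * u c i' := by
        simp only [hv', mul_ite, mul_one, mul_zero, Finset.sum_ite_eq, Finset.mem_univ, if_true]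
    _ = (uᴴ * ptrace2 ρ * u) i i' := by
        simp only [ptrace2, mul_apply, conjTranspose_apply, of_apply, Finset.sum_mul,
          Finset.mul_sum]
        exact Finset.sum_congr rfl fun c _ => Finset.sum_comm

lemma ptrace1_conj_kronecker (ρ : Matrix (Fin d₁ × Fin d₂) (Fin d₁ × Fin d₂) ℂ)
    {u : Matrix (Fin d₁) (Fin d₁) ℂ} (v : Matrix (Fin d₂) (Fin d₂) ℂ)
    (hu : u ∈ unitaryGroup (Fin d₁) ℂ) :
    ptrace1 ((u ⊗ₖ v)ᴴ * ρ * (u ⊗ₖ v)) = vᴴ * ptrace1 ρ * v := by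
  have hswap : (u ⊗ₖ v).submatrix Prod.swap Prod.swap = v ⊗ₖ u := by
    ext ⟨j, i⟩ ⟨j', i'⟩
    exact mul_comm _ _
  simp only [ptrace1_eq_ptrace2_submatrix_swap]
  rw [← ptrace2_conj_kronecker _ v hu, ← hswap, conjTranspose_submatrix]
  change ptrace2 (Matrix.submatrix _ (Equiv.prodComm _ _) (Equiv.prodComm _ _)) =
    ptrace2 (Matrix.submatrix _ (Equiv.prodComm _ _) (Equiv.prodComm _ _) *
      Matrix.submatrix _ (Equiv.prodComm _ _) (Equiv.prodComm _ _) *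
      Matrix.submatrix _ (Equiv.prodComm _ _) (Equiv.prodComm _ _))
  rw [submatrix_mul_equiv, submatrix_mul_equiv]

end

/-- **Theorem 2 (Audenaert / Raggio's conjecture).** For `q > 1` and any bipartite state `ρ`
on `ℂ^{d₁} ⊗ ℂ^{d₂}`, the Tsallis `q`-entropy is subadditive:
`S_q(ρ) ≤ S_q(Tr₁ρ) + S_q(Tr₂ρ)`. -/
theorem tsallisEntropy_subadditive {d₁ d₂ : ℕ} (q : ℝ) (hq : 1 < q)
    (ρ : Matrix (Fin d₁ × Fin d₂) (Fin d₁ × Fin d₂) ℂ)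
    (hρ : ρ.PosSemidef) (htr : ρ.trace = 1) :
    tsallisEntropy q ρ ≤ tsallisEntropy q (ptrace1 ρ) + tsallisEntropy q (ptrace2 ρ) := by
  set u := (ptrace2_isHermitian hρ.isHermitian).eigenvectorUnitary with hu
  set v := (ptrace1_isHermitian hρ.isHermitian).eigenvectorUnitary with hv
  set U : Matrix (Fin d₁ × Fin d₂) (Fin d₁ × Fin d₂) ℂ := u.1 ⊗ₖ v.1 with hU
  have hUmem : U ∈ unitaryGroup (Fin d₁ × Fin d₂) ℂ := kronecker_mem_unitary u.2 v.2
  set M := Uᴴ * ρ * U with hM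
  have hMpos : M.PosSemidef := hρ.conjTranspose_mul_mul_same U
  have hMtr : M.trace = 1 := by
    rw [hM, trace_mul_comm, ← Matrix.mul_assoc, ← star_eq_conjTranspose,
      mem_unitaryGroup_iff.1 hUmem, Matrix.one_mul, htr]
  set r : Fin d₁ → Fin d₂ → ℝ := fun i j => (M (i, j) (i, j)).re with hr
  have hr0 : ∀ i j, 0 ≤ r i j := fun i j => (Complex.le_def.1 hMpos.diag_nonneg).1
  have hrsum : ∑ i, ∑ j, r i j = 1 := by
    have := congrArg Complex.re hMtr
    simpa [trace, Fintype.sum_prod_type] using this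
  have hjoint : ∑ i, ∑ j, r i j ^ q ≤ traceRpow q ρ := by
    simpa only [Fintype.sum_prod_type] using sum_diag_rpow_le_traceRpow hq hρ hUmem
  have hfst : traceRpow q (ptrace2 ρ) = ∑ i, (∑ j, r i j) ^ q := by
    rw [traceRpow_eq_sum_diag (ptrace2_isHermitian hρ.isHermitian),
      ← ptrace2_conj_kronecker ρ _ v.2]
    simp [ptrace2, hr, hM, hU, hu]
  have hsnd : traceRpow q (ptrace1 ρ) = ∑ j, (∑ i, r i j) ^ q := by
    rw [traceRpow_eq_sum_diag (ptrace1_isHermitian hρ.isHermitian),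
      ← ptrace1_conj_kronecker ρ _ u.2]
    simp [ptrace1, hr, hM, hU, hv]
  have hmain := sum_rpow_marginals_le hq hr0 hrsum
  rw [← hfst, ← hsnd] at hmain
  simp only [tsallisEntropy]
  rw [← add_div]
  exact div_le_div_of_nonneg_right (by linarith) (by linarith)
end

section
/- Let q > 1 be a real number. Let x = (x₁, …, x_m) and y = (y₁, …, y_n) be two finite vectors of nonnegative real numbers normalized in the ℓ_q norm, i.e., ∑_i x_i^q = 1 and ∑_j y_j^q = 1. Then ∑_{i,j} ((x_i + y_j − 1)₊)^q ≤ 1. -/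
theorem le_one_of_sum_rpow_eq_one {ι : Type*} [Fintype ι] {q : ℝ} (hq : 0 < q) {x : ι → ℝ}
    (hx : ∀ i, 0 ≤ x i) (hsum : ∑ i, x i ^ q = 1) (i : ι) : x i ≤ 1 := by
  have h : x i ^ q ≤ 1 := hsum ▸
    Finset.single_le_sum (f := fun i => x i ^ q) (fun j _ => Real.rpow_nonneg (hx j) q)
      (Finset.mem_univ i)
  rwa [← Real.rpow_le_rpow_iff (hx i) zero_le_one hq, Real.one_rpow]

theorem max_zero_add_sub_one_le_mul {a b : ℝ} (ha : 0 ≤ a) (hb : 0 ≤ b) (ha1 : a ≤ 1)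
    (hb1 : b ≤ 1) : max 0 (a + b - 1) ≤ a * b :=
  max_le (mul_nonneg ha hb) (by nlinarith [mul_nonneg (sub_nonneg.2 ha1) (sub_nonneg.2 hb1)])

/-- **Lemma (Audenaert).** For `q > 1` and nonnegative vectors `x`, `y` normalized in the
`ℓ_q` norm (`∑ i, x i ^ q = 1` and `∑ j, y j ^ q = 1`), we have
`∑_{i,j} ((x i + y j − 1)₊)^q ≤ 1`, where `(t)₊ = max 0 t`. -/
theorem sum_posPart_rpow_le_one {m n : ℕ} (q : ℝ) (hq : 1 < q)
    (x : Fin m → ℝ) (y : Fin n → ℝ)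
    (hx : ∀ i, 0 ≤ x i) (hy : ∀ j, 0 ≤ y j)
    (hxnorm : ∑ i, x i ^ q = 1) (hynorm : ∑ j, y j ^ q = 1) :
    ∑ i, ∑ j, (max 0 (x i + y j - 1)) ^ q ≤ 1 := by
  have hq0 : 0 < q := one_pos.trans hq
  calc ∑ i, ∑ j, (max 0 (x i + y j - 1)) ^ q
      ≤ ∑ i, ∑ j, x i ^ q * y j ^ q := by
        refine Finset.sum_le_sum fun i _ => Finset.sum_le_sum fun j _ => ?_
        rw [← Real.mul_rpow (hx i) (hy j)]
        exact Real.rpow_le_rpow (le_max_left _ _)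
          (max_zero_add_sub_one_le_mul (hx i) (hy j) (le_one_of_sum_rpow_eq_one hq0 hx hxnorm i)
            (le_one_of_sum_rpow_eq_one hq0 hy hynorm j)) hq0.le
    _ = 1 := by rw [← Finset.sum_mul_sum, hxnorm, hynorm, one_mul]
end
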